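/- Let R be a commutative ring and Γₙ the Laurent polynomial ring in n variables over R. For 0 ≤ k ≤ n set C^k = Hom_R(Γₙ, Γₙ) ⊗_R ⋀^k(Rⁿ), and define ∂ : C^k → C^{k+1} by ∂(φ ⊗ ω) = Σ_{j=1}^{n} dⱼ(φ) ⊗ (eⱼ ∧ ω), where dⱼ(φ) = φ − M_{zⱼ} ∘ φ ∘ M_{zⱼ⁻¹} and e₁,…,eₙ is the standard basis of Rⁿ. Then ∂ ∘ ∂ = 0, the kernel of ∂ : C⁰ → C¹ is exactly {M_g ⊗ 1 : g ∈ Γₙ} ≅ Γₙ, and the complex is exact in every positive degree: for 1 ≤ k, ker(∂ : C^k → C^{k+1}) = im(∂ : C^{k−1} → C^k). In other words, the cohomology of (C^•, ∂) is the group ring Γₙ concentrated in degree 0, embedded as the multiplication operators. -/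

import Mathlib

open TensorProduct

set_option synthInstance.maxHeartbeats 1000000
set_option maxHeartbeats 2000000

/-- The monomial `z^α` in the Laurent polynomial ring in `n` variables over `R`. -/
noncomputable def zmon {R : Type*} [CommRing R] {n : ℕ} (α : Fin n → ℤ) :
    AddMonoidAlgebra R (Fin n → ℤ) :=
  AddMonoidAlgebra.single α 1

/-- `dⱼ = (φ ↦ φ − M_{zⱼ} ∘ φ ∘ M_{zⱼ⁻¹})`, as an `R`-linear endomorphism of
`Hom_R(Γₙ, Γₙ)`. -/
noncomputable def torusDiffLin (R : Type*) [CommRing R] (n : ℕ) (j : Fin n) :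
    (AddMonoidAlgebra R (Fin n → ℤ) →ₗ[R] AddMonoidAlgebra R (Fin n → ℤ)) →ₗ[R]
      (AddMonoidAlgebra R (Fin n → ℤ) →ₗ[R] AddMonoidAlgebra R (Fin n → ℤ)) :=
  LinearMap.id -
    (LinearMap.llcomp R (AddMonoidAlgebra R (Fin n → ℤ)) (AddMonoidAlgebra R (Fin n → ℤ))
        (AddMonoidAlgebra R (Fin n → ℤ)) (LinearMap.mulLeft R (zmon (Pi.single j 1)))).comp
      (LinearMap.lcomp R (AddMonoidAlgebra R (Fin n → ℤ))
        (LinearMap.mulLeft R (zmon (-(Pi.single j 1)))))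

/-- Left exterior multiplication by a vector `v`, as a linear map `⋀^k M → ⋀^{k+1} M`. -/
noncomputable def wedgeL (R : Type*) [CommRing R] (M : Type*) [AddCommGroup M] [Module R M]
    (v : M) (k : ℕ) : (⋀[R]^k M) →ₗ[R] (⋀[R]^(k + 1) M) :=
  LinearMap.codRestrict (⋀[R]^(k + 1) M)
    ((LinearMap.mulLeft R (ExteriorAlgebra.ι R v)).comp (Submodule.subtype (⋀[R]^k M)))
    (fun x => by
      have hv : ExteriorAlgebra.ι R v ∈
          LinearMap.range (ExteriorAlgebra.ι R : M →ₗ[R] ExteriorAlgebra R M) :=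
        LinearMap.mem_range_self _ v
      have h := Submodule.mul_mem_mul hv x.2
      rwa [← pow_succ'] at h)

/-- The Koszul-type differential `∂(φ ⊗ ω) = Σⱼ dⱼ(φ) ⊗ (eⱼ ∧ ω)` on
`C^k = Hom_R(Γₙ,Γₙ) ⊗ ⋀^k(Rⁿ)`. -/
noncomputable def koszulD (R : Type*) [CommRing R] (n : ℕ) (k : ℕ) :
    ((AddMonoidAlgebra R (Fin n → ℤ) →ₗ[R] AddMonoidAlgebra R (Fin n → ℤ)) ⊗[R]
        (⋀[R]^k (Fin n → R))) →ₗ[R]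
      ((AddMonoidAlgebra R (Fin n → ℤ) →ₗ[R] AddMonoidAlgebra R (Fin n → ℤ)) ⊗[R]
        (⋀[R]^(k + 1) (Fin n → R))) :=
  ∑ j : Fin n,
    TensorProduct.map (torusDiffLin R n j) (wedgeL R (Fin n → R) (Pi.single j 1) k)

/-- The canonical generator `1 ∈ ⋀^0(Rⁿ)`. -/
noncomputable def extOne (R : Type*) [CommRing R] (M : Type*) [AddCommGroup M] [Module R M] :
    ⋀[R]^0 M :=
  ⟨1, by
    show (1 : ExteriorAlgebra R M) ∈
      LinearMap.range (ExteriorAlgebra.ι R : M →ₗ[R] ExteriorAlgebra R M) ^ 0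
    rw [pow_zero]
    exact Submodule.one_le.mp le_rfl⟩

section ExteriorContraction

variable {R : Type*} [CommRing R] {M : Type*} [AddCommGroup M] [Module R M]

/-- Contraction with a linear form lowers the exterior degree by one. -/
theorem contractLeft_mem_exteriorPower (f : Module.Dual R M) (k : ℕ)
    {x : ExteriorAlgebra R M} (hx : x ∈ ⋀[R]^(k + 1) M) :
    CliffordAlgebra.contractLeft (Q := (0 : QuadraticForm R M)) f x ∈ ⋀[R]^k M := by
  induction k generalizing x with
  | zero =>
    obtain ⟨v, rfl⟩ : x ∈ LinearMap.range (ExteriorAlgebra.ι R : M →ₗ[R] _) := by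
      simpa using hx
    refine (CliffordAlgebra.contractLeft_ι (Q := (0 : QuadraticForm R M)) f v).symm ▸ ?_
    exact Submodule.algebraMap_mem _
  | succ k ih =>
    have hx' : x ∈ LinearMap.range (ExteriorAlgebra.ι R : M →ₗ[R] _) * ⋀[R]^(k + 1) M := by
      rwa [← pow_succ']
    induction hx' using Submodule.mul_induction_on' with
    | mem_mul_mem m hm y hy =>
      obtain ⟨v, rfl⟩ := hm
      refine (CliffordAlgebra.contractLeft_ι_mul (Q := (0 : QuadraticForm R M)) f v y).symm ▸ ?_
      refine Submodule.sub_mem _ (Submodule.smul_mem _ _ hy) ?_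
      have h := Submodule.mul_mem_mul (LinearMap.mem_range_self (ExteriorAlgebra.ι R) v) (ih hy)
      rwa [← pow_succ'] at h
    | add a ha b hb iha ihb =>
      have e : ∀ z ∈ LinearMap.range (ExteriorAlgebra.ι R : M →ₗ[R] _) * ⋀[R]^(k + 1) M,
          z ∈ ⋀[R]^(k + 1 + 1) M := fun z hz => by rwa [← pow_succ'] at hz
      rw [map_add]
      exact Submodule.add_mem _ (iha (e a ha)) (ihb (e b hb))

/-- Contraction with a linear form, as a linear map `⋀^{k+1} M → ⋀^k M`. -/
noncomputable def contractL (f : Module.Dual R M) (k : ℕ) :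
    (⋀[R]^(k + 1) M) →ₗ[R] (⋀[R]^k M) :=
  (CliffordAlgebra.contractLeft (Q := (0 : QuadraticForm R M)) f).restrict
    fun _ hx => contractLeft_mem_exteriorPower f k hx

theorem coe_wedgeL (v : M) (k : ℕ) (x : ⋀[R]^k M) :
    (wedgeL R M v k x : ExteriorAlgebra R M) = ExteriorAlgebra.ι R v * x := rfl

theorem coe_contractL (f : Module.Dual R M) (k : ℕ) (x : ⋀[R]^(k + 1) M) :
    (contractL f k x : ExteriorAlgebra R M) =
      CliffordAlgebra.contractLeft (Q := (0 : QuadraticForm R M)) f x := rfl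

theorem wedgeL_contractL_add (f : Module.Dual R M) (v : M) (k : ℕ) (x : ⋀[R]^(k + 1) M) :
    wedgeL R M v k (contractL f k x) + contractL f (k + 1) (wedgeL R M v (k + 1) x) =
      f v • x := by
  apply Subtype.ext
  have h := CliffordAlgebra.contractLeft_ι_mul (Q := (0 : QuadraticForm R M)) f v x
  rw [Submodule.coe_add, coe_wedgeL, coe_contractL, coe_contractL, coe_wedgeL, Submodule.coe_smul]
  exact (congrArg _ h).trans (add_sub_cancel _ _)

theorem contractL_zero_wedgeL (f : Module.Dual R M) (v : M) (x : ⋀[R]^0 M) :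
    contractL f 0 (wedgeL R M v 0 x) = f v • x := by
  apply Subtype.ext
  obtain ⟨x, hx⟩ := x
  obtain ⟨r, rfl⟩ : ∃ r, algebraMap R (ExteriorAlgebra R M) r = x := by
    simpa [Submodule.mem_one] using hx
  have h := CliffordAlgebra.contractLeft_ι_mul (Q := (0 : QuadraticForm R M)) f v
    (algebraMap R _ r)
  rw [CliffordAlgebra.contractLeft_algebraMap, mul_zero, sub_zero] at h
  exact h

theorem wedgeL_wedgeL_self (v : M) (k : ℕ) (x : ⋀[R]^k M) :
    wedgeL R M v (k + 1) (wedgeL R M v k x) = 0 := by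
  apply Subtype.ext
  simp only [coe_wedgeL, ← mul_assoc, ExteriorAlgebra.ι_sq_zero, zero_mul, Submodule.coe_zero]

theorem wedgeL_wedgeL_add_swap (v w : M) (k : ℕ) (x : ⋀[R]^k M) :
    wedgeL R M v (k + 1) (wedgeL R M w k x) + wedgeL R M w (k + 1) (wedgeL R M v k x) = 0 := by
  apply Subtype.ext
  simp only [Submodule.coe_add, coe_wedgeL, ← mul_assoc, ← add_mul,
    ExteriorAlgebra.ι_add_mul_swap, zero_mul, Submodule.coe_zero]

/-- The projection of `⋀^k M` onto the forms that do not involve `v`, when `f v = 1`. -/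
noncomputable def wedgeProj (f : Module.Dual R M) (v : M) (k : ℕ) :
    (⋀[R]^k M) →ₗ[R] (⋀[R]^k M) :=
  (contractL f k).comp (wedgeL R M v k)

theorem wedgeProj_wedgeL_self (f : Module.Dual R M) (v : M) (k : ℕ) (x : ⋀[R]^k M) :
    wedgeProj f v (k + 1) (wedgeL R M v k x) = 0 := by
  simp [wedgeProj, wedgeL_wedgeL_self]

theorem wedgeProj_wedgeL_of_eq_zero (f : Module.Dual R M) (v w : M) (hw : f w = 0) (k : ℕ)
    (x : ⋀[R]^k M) :
    wedgeProj f v (k + 1) (wedgeL R M w k x) = wedgeL R M w k (wedgeProj f v k x) := by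
  have h₁ := eq_neg_of_add_eq_zero_left (wedgeL_wedgeL_add_swap v w k x)
  have h₂ := wedgeL_contractL_add f w k (wedgeL R M v k x)
  rw [hw, zero_smul] at h₂
  simp only [wedgeProj, LinearMap.comp_apply, h₁, map_neg]
  exact (eq_neg_of_add_eq_zero_left h₂).symm

theorem zeroEquiv_extOne : exteriorPower.zeroEquiv R M (extOne R M) = 1 := by
  have h : extOne R M = exteriorPower.ιMulti R 0 (fun i : Fin 0 => i.elim0) := by
    apply Subtype.ext
    simp [extOne, exteriorPower.ιMulti_apply_coe, ExteriorAlgebra.ιMulti_apply]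
  rw [h, exteriorPower.zeroEquiv_ιMulti]

theorem eq_smul_extOne (x : ⋀[R]^0 M) : x = exteriorPower.zeroEquiv R M x • extOne R M :=
  (exteriorPower.zeroEquiv R M).injective (by simp [zeroEquiv_extOne])

variable {H : Type*} [AddCommGroup H] [Module R H]

theorem tmul_extOne_injective : Function.Injective (fun h : H => h ⊗ₜ[R] extOne R M) := by
  intro a b hab
  simpa [zeroEquiv_extOne] using
    congrArg (TensorProduct.rid R H ∘ (exteriorPower.zeroEquiv R M).toLinearMap.lTensor H) hab

theorem exists_eq_tmul_extOne (x : H ⊗[R] (⋀[R]^0 M)) : ∃ h : H, x = h ⊗ₜ extOne R M := by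
  induction x with
  | zero => exact ⟨0, by simp⟩
  | tmul a b =>
    exact ⟨exteriorPower.zeroEquiv R M b • a, by
      conv_lhs => rw [eq_smul_extOne b]
      rw [TensorProduct.tmul_smul, TensorProduct.smul_tmul']⟩
  | add x y hx hy =>
    obtain ⟨a, rfl⟩ := hx
    obtain ⟨b, rfl⟩ := hy
    exact ⟨a + b, (TensorProduct.add_tmul _ _ _).symm⟩

/-- A linear map out of `H ⊗ ⋀^{k+1}(Rⁿ)` vanishes if it vanishes on all `h ⊗ (eᵢ ∧ ω)`. -/
theorem eq_zero_of_forall_tmul_wedgeL {n : ℕ} {N : Type*} [AddCommGroup N] [Module R N] (k : ℕ)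
    (F : H ⊗[R] (⋀[R]^(k + 1) (Fin n → R)) →ₗ[R] N)
    (hF : ∀ h i ω, F (h ⊗ₜ wedgeL R (Fin n → R) (Pi.single i 1) k ω) = 0) : F = 0 := by
  have key : ∀ h (v : Fin n → R) ω, F (h ⊗ₜ wedgeL R (Fin n → R) v k ω) = 0 := by
    intro h v ω
    have e : wedgeL R (Fin n → R) v k ω =
        ∑ i, v i • wedgeL R (Fin n → R) (Pi.single i 1) k ω := by
      apply Subtype.ext
      conv_lhs => rw [coe_wedgeL, pi_eq_sum_univ' v]
      simp [coe_wedgeL, Finset.sum_mul]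
    simp [e, TensorProduct.tmul_sum, hF]
  refine TensorProduct.ext' fun h ω => ?_
  rw [LinearMap.zero_apply]
  obtain ⟨ω, hω⟩ := ω
  have hω' : ω ∈ LinearMap.range (ExteriorAlgebra.ι R : (Fin n → R) →ₗ[R] _) *
      ⋀[R]^k (Fin n → R) := by rwa [← pow_succ']
  induction hω' using Submodule.mul_induction_on' with
  | mem_mul_mem m hm y hy =>
    obtain ⟨v, rfl⟩ := hm
    exact key h v ⟨y, hy⟩
  | add a ha b hb iha ihb =>
    have ha' : a ∈ ⋀[R]^(k + 1) (Fin n → R) := by rwa [← pow_succ'] at ha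
    have hb' : b ∈ ⋀[R]^(k + 1) (Fin n → R) := by rwa [← pow_succ'] at hb
    have h₃ := congrArg₂ (· + ·) (iha ha') (ihb hb')
    rw [add_zero] at h₃
    simp only [← map_add, ← TensorProduct.tmul_add] at h₃
    exact h₃

end ExteriorContraction

section KoszulComplex

variable {R : Type*} [CommRing R] {n : ℕ} {H : Type*} [AddCommGroup H] [Module R H]

/-- The Koszul differential `h ⊗ ω ↦ ∑ⱼ dⱼ h ⊗ (eⱼ ∧ ω)` of a family of endomorphisms. -/
noncomputable def koszulMap (d : Fin n → H →ₗ[R] H) (k : ℕ) :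
    (H ⊗[R] (⋀[R]^k (Fin n → R))) →ₗ[R] (H ⊗[R] (⋀[R]^(k + 1) (Fin n → R))) :=
  ∑ j : Fin n, TensorProduct.map (d j) (wedgeL R (Fin n → R) (Pi.single j 1) k)

theorem koszulMap_tmul (d : Fin n → H →ₗ[R] H) (k : ℕ) (h : H) (ω : ⋀[R]^k (Fin n → R)) :
    koszulMap d k (h ⊗ₜ ω) = ∑ j, d j h ⊗ₜ wedgeL R (Fin n → R) (Pi.single j 1) k ω := by
  simp [koszulMap]

theorem koszulMap_koszulMap (d : Fin n → H →ₗ[R] H) (hd : ∀ i j h, d i (d j h) = d j (d i h))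
    (k : ℕ) (x : H ⊗[R] (⋀[R]^k (Fin n → R))) :
    koszulMap d (k + 1) (koszulMap d k x) = 0 := by
  suffices (koszulMap d (k + 1)).comp (koszulMap d k) = 0 from LinearMap.congr_fun this x
  refine TensorProduct.ext' fun h ω => ?_
  simp only [LinearMap.comp_apply, koszulMap_tmul, map_sum, LinearMap.zero_apply]
  rw [← Finset.sum_product']
  refine Finset.sum_involution (fun p _ => p.swap) (fun p _ => ?_) (fun p _ hp => ?_)
    (fun _ _ => Finset.mem_univ _) (fun _ _ => rfl)
  · rw [Prod.fst_swap, Prod.snd_swap, hd p.1 p.2, ← TensorProduct.tmul_add,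
      wedgeL_wedgeL_add_swap, TensorProduct.tmul_zero]
  · contrapose! hp
    obtain ⟨i, j⟩ := p
    obtain rfl : j = i := congrArg Prod.fst hp
    rw [wedgeL_wedgeL_self, TensorProduct.tmul_zero]

theorem koszulMap_zero_tmul_extOne_eq_zero_iff (d : Fin n → H →ₗ[R] H) (h : H) :
    koszulMap d 0 (h ⊗ₜ extOne R (Fin n → R)) = 0 ↔ ∀ i, d i h = 0 := by
  refine ⟨fun hx i => tmul_extOne_injective (R := R) (M := Fin n → R) ?_, fun hx => ?_⟩
  · have := congrArg ((contractL (LinearMap.proj i) 0).lTensor H) hx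
    simpa [koszulMap_tmul, contractL_zero_wedgeL, Pi.single_apply, TensorProduct.tmul_smul,
      ite_smul, TensorProduct.tmul_ite] using this
  · simp [koszulMap_tmul, hx]

/-- For `s` a section of `dᵢ`, the projection `1 - s dᵢ` onto the kernel of `dᵢ`, tensored with
the projection onto the forms not involving `eᵢ`. -/
noncomputable def koszulProj (d s : Fin n → H →ₗ[R] H) (i : Fin n) (k : ℕ) :
    (H ⊗[R] (⋀[R]^k (Fin n → R))) →ₗ[R] (H ⊗[R] (⋀[R]^k (Fin n → R))) :=
  TensorProduct.map (LinearMap.id - (s i).comp (d i))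
    (wedgeProj (LinearMap.proj i) (Pi.single i 1) k)

theorem koszulProj_tmul_wedgeL_self (d s : Fin n → H →ₗ[R] H) (i : Fin n) (k : ℕ) (h : H)
    (ω : ⋀[R]^k (Fin n → R)) :
    koszulProj d s i (k + 1) (h ⊗ₜ wedgeL R (Fin n → R) (Pi.single i 1) k ω) = 0 := by
  simp [koszulProj, wedgeProj_wedgeL_self]

theorem koszulProj_lTensor_wedgeL_of_ne (d s : Fin n → H →ₗ[R] H) {i j : Fin n} (hij : i ≠ j)
    (k : ℕ) (x : H ⊗[R] (⋀[R]^k (Fin n → R))) :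
    koszulProj d s i (k + 1) ((wedgeL R (Fin n → R) (Pi.single j 1) k).lTensor H x) =
      (wedgeL R (Fin n → R) (Pi.single j 1) k).lTensor H (koszulProj d s i k x) := by
  induction x with
  | zero => simp
  | tmul h ω =>
    simp only [koszulProj, LinearMap.lTensor_tmul, TensorProduct.map_tmul]
    rw [wedgeProj_wedgeL_of_eq_zero _ _ _ (by simp [hij])]
  | add x y hx hy => simp only [map_add, hx, hy]

/-- Applying `koszulProj` for every index in a list. -/
noncomputable def koszulProjList (d s : Fin n → H →ₗ[R] H) (k : ℕ) (l : List (Fin n)) :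
    (H ⊗[R] (⋀[R]^k (Fin n → R))) →ₗ[R] (H ⊗[R] (⋀[R]^k (Fin n → R))) :=
  l.foldr (fun i F => (koszulProj d s i k).comp F) LinearMap.id

theorem koszulProjList_lTensor_wedgeL_of_notMem (d s : Fin n → H →ₗ[R] H) (k : ℕ)
    (l : List (Fin n)) (j : Fin n) (hj : j ∉ l) (x : H ⊗[R] (⋀[R]^k (Fin n → R))) :
    koszulProjList d s (k + 1) l ((wedgeL R (Fin n → R) (Pi.single j 1) k).lTensor H x) =
      (wedgeL R (Fin n → R) (Pi.single j 1) k).lTensor H (koszulProjList d s k l x) := by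
  induction l with
  | nil => rfl
  | cons a l ih =>
    rw [List.mem_cons, not_or] at hj
    change koszulProj d s a (k + 1) (koszulProjList d s (k + 1) l _) = _
    rw [ih hj.2, koszulProj_lTensor_wedgeL_of_ne d s (Ne.symm hj.1)]
    rfl

theorem koszulProjList_lTensor_wedgeL_of_mem (d s : Fin n → H →ₗ[R] H) (k : ℕ)
    (l : List (Fin n)) (j : Fin n) (hj : j ∈ l) (x : H ⊗[R] (⋀[R]^k (Fin n → R))) :
    koszulProjList d s (k + 1) l ((wedgeL R (Fin n → R) (Pi.single j 1) k).lTensor H x) = 0 := by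
  induction l with
  | nil => simp at hj
  | cons a l ih =>
    change koszulProj d s a (k + 1) (koszulProjList d s (k + 1) l _) = 0
    by_cases hl : j ∈ l
    · rw [ih hl, map_zero]
    · obtain rfl : j = a := by simpa [hl] using hj
      rw [koszulProjList_lTensor_wedgeL_of_notMem d s k l j hl]
      generalize koszulProjList d s k l x = y
      induction y with
      | zero => simp
      | tmul h ω => exact koszulProj_tmul_wedgeL_self d s j k h ω
      | add x y hx hy => simp only [map_add, hx, hy, add_zero]

theorem koszulProjList_finRange (d s : Fin n → H →ₗ[R] H) (k : ℕ) :
    koszulProjList d s (k + 1) (List.finRange n) = 0 :=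
  eq_zero_of_forall_tmul_wedgeL k _ fun h i ω =>
    koszulProjList_lTensor_wedgeL_of_mem d s k _ i (List.mem_finRange i) (h ⊗ₜ ω)

/-- The homotopy identity `∂ Sᵢ + Sᵢ ∂ = 1 - Pᵢ`, where `Sᵢ (h ⊗ ω) = sᵢ h ⊗ ι(eᵢ*) ω`. -/
theorem koszulMap_homotopy (d s : Fin n → H →ₗ[R] H) (hs : ∀ i h, d i (s i h) = h)
    (hds : ∀ i j, i ≠ j → ∀ h, d i (s j h) = s j (d i h)) (i : Fin n) (k : ℕ)
    (x : H ⊗[R] (⋀[R]^(k + 1) (Fin n → R))) :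
    koszulMap d k (TensorProduct.map (s i) (contractL (LinearMap.proj i) k) x) +
      TensorProduct.map (s i) (contractL (LinearMap.proj i) (k + 1)) (koszulMap d (k + 1) x) =
      x - koszulProj d s i (k + 1) x := by
  induction x with
  | zero => simp
  | tmul h ω =>
    simp only [koszulMap_tmul, TensorProduct.map_tmul, map_sum, ← Finset.sum_add_distrib]
    rw [Finset.sum_eq_single i]
    · have h₁ := wedgeL_contractL_add (LinearMap.proj i) (Pi.single i (1 : R)) k ω
      rw [LinearMap.proj_apply, Pi.single_eq_same, one_smul] at h₁
      simp only [koszulProj, wedgeProj, TensorProduct.map_tmul, LinearMap.comp_apply, hs,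
        LinearMap.sub_apply, LinearMap.id_apply, TensorProduct.sub_tmul]
      rw [eq_sub_of_add_eq h₁, TensorProduct.tmul_sub]
      abel
    · intro j _ hj
      have h₁ := wedgeL_contractL_add (LinearMap.proj i) (Pi.single j (1 : R)) k ω
      rw [LinearMap.proj_apply, Pi.single_eq_of_ne hj.symm, zero_smul] at h₁
      rw [hds j i hj, ← TensorProduct.tmul_add, h₁, TensorProduct.tmul_zero]
    · simp
  | add x y hx hy =>
    simp only [map_add]
    rw [add_sub_add_comm, ← hx, ← hy]
    abel

theorem koszulMap_koszulProj (d s : Fin n → H →ₗ[R] H)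
    (hd : ∀ i j h, d i (d j h) = d j (d i h)) (hs : ∀ i h, d i (s i h) = h)
    (hds : ∀ i j, i ≠ j → ∀ h, d i (s j h) = s j (d i h)) (i : Fin n) (k : ℕ)
    (x : H ⊗[R] (⋀[R]^k (Fin n → R))) :
    koszulMap d k (koszulProj d s i k x) = koszulProj d s i (k + 1) (koszulMap d k x) := by
  induction x with
  | zero => simp
  | tmul h ω =>
    simp only [koszulProj, koszulMap_tmul, TensorProduct.map_tmul, map_sum]
    refine Finset.sum_congr rfl fun j _ => ?_
    obtain rfl | hij := eq_or_ne i j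
    · simp [hs, wedgeProj_wedgeL_self]
    · rw [wedgeProj_wedgeL_of_eq_zero _ _ _ (by simp [hij])]
      simp [hds j i hij.symm, hd j i]
  | add x y hx hy => simp only [map_add, hx, hy]

/-- If the commuting endomorphisms `dᵢ` have sections `sᵢ` that commute with `dⱼ` for `j ≠ i`,
then the Koszul complex is exact in positive degrees. -/
theorem koszulMap_exact (d s : Fin n → H →ₗ[R] H)
    (hd : ∀ i j h, d i (d j h) = d j (d i h)) (hs : ∀ i h, d i (s i h) = h)
    (hds : ∀ i j, i ≠ j → ∀ h, d i (s j h) = s j (d i h)) (k : ℕ)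
    (x : H ⊗[R] (⋀[R]^(k + 1) (Fin n → R))) :
    koszulMap d (k + 1) x = 0 ↔ ∃ y, koszulMap d k y = x := by
  refine ⟨fun hx => ?_, ?_⟩
  · have key : ∀ l : List (Fin n), koszulMap d (k + 1) (koszulProjList d s (k + 1) l x) = 0 ∧
        ∃ y, koszulMap d k y = x - koszulProjList d s (k + 1) l x := by
      intro l
      induction l with
      | nil => exact ⟨hx, 0, by simp [koszulProjList]⟩
      | cons a l ih =>
        obtain ⟨h₁, y, hy⟩ := ih
        have h₂ := koszulMap_homotopy d s hs hds a k (koszulProjList d s (k + 1) l x)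
        rw [h₁, map_zero, add_zero] at h₂
        change koszulMap d (k + 1) (koszulProj d s a (k + 1) (koszulProjList d s (k + 1) l x)) = 0 ∧
          ∃ y, koszulMap d k y = x - koszulProj d s a (k + 1) (koszulProjList d s (k + 1) l x)
        exact ⟨by rw [koszulMap_koszulProj d s hd hs hds, h₁, map_zero],
          y + TensorProduct.map (s a) (contractL (LinearMap.proj a) k)
            (koszulProjList d s (k + 1) l x), by rw [map_add, hy, h₂, sub_add_sub_cancel]⟩
    obtain ⟨-, y, hy⟩ := key (List.finRange n)
    exact ⟨y, by rw [hy, koszulProjList_finRange, LinearMap.zero_apply, sub_zero]⟩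
  · rintro ⟨y, rfl⟩
    exact koszulMap_koszulMap d hd k y

end KoszulComplex

section DiscreteIntegral

variable {R : Type*} [CommRing R] {N : Type*} [AddCommGroup N] [Module R N] {n : ℕ}

/-- Discrete integral of `f : ℤ → N`, based at `0`. -/
noncomputable def discreteIntegral (f : ℤ → N) (m : ℤ) : N :=
  ∑ i ∈ Finset.Ioc 0 m, f i - ∑ i ∈ Finset.Ioc m 0, f i

theorem discreteIntegral_sub_pred (f : ℤ → N) (m : ℤ) :
    discreteIntegral f m - discreteIntegral f (m - 1) = f m := by
  unfold discreteIntegral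
  rcases lt_or_ge 0 m with hm | hm
  · have h₁ : Finset.Ioc 0 m = insert m (Finset.Ioc 0 (m - 1)) := by
      ext i; simp; omega
    rw [h₁, Finset.sum_insert (by simp), Finset.Ioc_eq_empty_of_le hm.le,
      Finset.Ioc_eq_empty_of_le (by omega : (0 : ℤ) ≤ m - 1)]
    abel
  · have h₁ : Finset.Ioc (m - 1) 0 = insert m (Finset.Ioc m 0) := by
      ext i; simp; omega
    rw [h₁, Finset.sum_insert (by simp), Finset.Ioc_eq_empty_of_le hm,
      Finset.Ioc_eq_empty_of_le (by omega : m - 1 ≤ (0 : ℤ))]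
    abel

/-- Discrete integration in the `j`-th variable. -/
noncomputable def partialIntegral (R : Type*) [CommRing R] {N : Type*} [AddCommGroup N] [Module R N] {n : ℕ}
    (j : Fin n) : ((Fin n → ℤ) → N) →ₗ[R] ((Fin n → ℤ) → N) where
  toFun ψ α := discreteIntegral (fun m => ψ (Function.update α j m)) (α j)
  map_add' ψ χ := by
    ext α
    simp only [discreteIntegral, Pi.add_apply, Finset.sum_add_distrib]
    abel
  map_smul' r ψ := by
    ext α
    simp [discreteIntegral, Finset.smul_sum, smul_sub]

/-- The backward difference in the `j`-th variable. -/
noncomputable def partialDifference (R : Type*) [CommRing R] {N : Type*} [AddCommGroup N] [Module R N] {n : ℕ}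
    (j : Fin n) : ((Fin n → ℤ) → N) →ₗ[R] ((Fin n → ℤ) → N) :=
  LinearMap.id - LinearMap.funLeft R N (fun α => α - Pi.single j 1)

theorem partialDifference_apply (j : Fin n) (ψ : (Fin n → ℤ) → N) (α : Fin n → ℤ) :
    partialDifference R j ψ α = ψ α - ψ (α - Pi.single j 1) := rfl

theorem partialDifference_comm (i j : Fin n) (ψ : (Fin n → ℤ) → N) :
    partialDifference R i (partialDifference R j ψ) =
      partialDifference R j (partialDifference R i ψ) := by
  ext α
  simp only [partialDifference_apply, sub_right_comm α (Pi.single i 1)]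
  abel

theorem partialDifference_partialIntegral (j : Fin n) (ψ : (Fin n → ℤ) → N) :
    partialDifference R j (partialIntegral R j ψ) = ψ := by
  ext α
  have h : ∀ m, Function.update (α - Pi.single j 1) j m = Function.update α j m := by
    intro m
    ext i
    by_cases hi : i = j <;> simp [hi]
  have := discreteIntegral_sub_pred (fun m => ψ (Function.update α j m)) (α j)
  rw [Function.update_eq_self] at this
  simpa [partialDifference_apply, partialIntegral, h] using this

theorem partialDifference_partialIntegral_of_ne {i j : Fin n} (hij : i ≠ j)
    (ψ : (Fin n → ℤ) → N) :
    partialDifference R i (partialIntegral R j ψ) =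
      partialIntegral R j (partialDifference R i ψ) := by
  ext α
  have h : ∀ m, Function.update (α - Pi.single i 1) j m =
      Function.update α j m - Pi.single i 1 := by
    intro m
    ext a
    by_cases ha : a = j
    · subst ha; simp [hij.symm]
    · simp [ha]
  simp only [partialDifference_apply, partialIntegral, LinearMap.coe_mk, AddHom.coe_mk, h,
    Pi.sub_apply, Pi.single_eq_of_ne hij.symm, sub_zero, discreteIntegral,
    Finset.sum_sub_distrib]
  abel

end DiscreteIntegral

section TorusDifferential

variable {R : Type*} [CommRing R] {n : ℕ}

theorem zmon_mul_zmon (α β : Fin n → ℤ) :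
    (zmon α * zmon β : AddMonoidAlgebra R (Fin n → ℤ)) = zmon (α + β) := by
  simp [zmon, AddMonoidAlgebra.single_mul_single]

theorem zmon_zero : (zmon 0 : AddMonoidAlgebra R (Fin n → ℤ)) = 1 := rfl

theorem zmon_mul_cancel (α β : Fin n → ℤ) (h : α + β = 0) (g : AddMonoidAlgebra R (Fin n → ℤ)) :
    zmon α * (zmon β * g) = g := by
  rw [← mul_assoc, zmon_mul_zmon, h, zmon_zero, one_mul]

theorem basis_eq_zmon (α : Fin n → ℤ) :
    AddMonoidAlgebra.basis (Fin n → ℤ) R α = zmon α := by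
  rw [AddMonoidAlgebra.basis_apply, zmon]

theorem torusDiffLin_apply (j : Fin n)
    (φ : AddMonoidAlgebra R (Fin n → ℤ) →ₗ[R] AddMonoidAlgebra R (Fin n → ℤ))
    (g : AddMonoidAlgebra R (Fin n → ℤ)) :
    torusDiffLin R n j φ g = φ g - zmon (Pi.single j 1) * φ (zmon (-Pi.single j 1) * g) := rfl

/-- An endomorphism `φ` of `Γₙ` corresponds to the function `α ↦ z^{-α} φ(z^α)`. -/
noncomputable def twistEquiv (R : Type*) [CommRing R] (n : ℕ) :
    (AddMonoidAlgebra R (Fin n → ℤ) →ₗ[R] AddMonoidAlgebra R (Fin n → ℤ)) ≃ₗ[R]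
      ((Fin n → ℤ) → AddMonoidAlgebra R (Fin n → ℤ)) :=
  ((AddMonoidAlgebra.basis (Fin n → ℤ) R).constr R).symm.trans
    { toFun := fun ψ α => zmon (-α) * ψ α
      map_add' := fun ψ χ => by ext1 α; simp [mul_add]
      map_smul' := fun r ψ => by ext1 α; simp
      invFun := fun ψ α => zmon α * ψ α
      left_inv := fun ψ => by ext1 α; exact zmon_mul_cancel _ _ (by simp) _
      right_inv := fun ψ => by ext1 α; exact zmon_mul_cancel _ _ (by simp) _ }

theorem twistEquiv_apply
    (φ : AddMonoidAlgebra R (Fin n → ℤ) →ₗ[R] AddMonoidAlgebra R (Fin n → ℤ)) (α : Fin n → ℤ) :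
    twistEquiv R n φ α = zmon (-α) * φ (zmon α) := by
  rw [← basis_eq_zmon α]
  rfl

theorem twistEquiv_torusDiffLin (j : Fin n)
    (φ : AddMonoidAlgebra R (Fin n → ℤ) →ₗ[R] AddMonoidAlgebra R (Fin n → ℤ)) :
    twistEquiv R n (torusDiffLin R n j φ) = partialDifference R j (twistEquiv R n φ) := by
  ext1 α
  rw [partialDifference_apply, twistEquiv_apply, twistEquiv_apply, twistEquiv_apply,
    torusDiffLin_apply, mul_sub, ← mul_assoc, zmon_mul_zmon, zmon_mul_zmon,
    neg_add_eq_sub, neg_add_eq_sub, neg_sub]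

theorem forall_torusDiffLin_eq_zero_iff
    (φ : AddMonoidAlgebra R (Fin n → ℤ) →ₗ[R] AddMonoidAlgebra R (Fin n → ℤ)) :
    (∀ j, torusDiffLin R n j φ = 0) ↔ ∃ g, φ = LinearMap.mulLeft R g := by
  refine ⟨fun h => ⟨φ 1, ?_⟩, ?_⟩
  · have hper : ∀ j, ∀ α, twistEquiv R n φ (α - Pi.single j 1) = twistEquiv R n φ α := by
      intro j α
      have h₁ := congrFun (twistEquiv_torusDiffLin j φ) α
      rw [h j, map_zero, partialDifference_apply] at h₁
      exact (sub_eq_zero.mp h₁.symm).symm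
    let S : AddSubgroup (Fin n → ℤ) :=
      { carrier := {β | ∀ α, twistEquiv R n φ (α - β) = twistEquiv R n φ α}
        zero_mem' := fun α => by rw [sub_zero]
        add_mem' := fun {a b} ha hb α => by rw [← sub_sub, hb, ha]
        neg_mem' := fun {a} ha α => by rw [← ha (α - -a), sub_neg_eq_add, add_sub_cancel_right] }
    have hS : ∀ β, β ∈ S := by
      intro β
      have e : β = ∑ j, β j • (Pi.single j 1 : Fin n → ℤ) := by
        simpa using pi_eq_sum_univ' β
      rw [e]
      exact sum_mem fun j _ => zsmul_mem (show Pi.single j 1 ∈ S from hper j) _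
    refine (AddMonoidAlgebra.basis (Fin n → ℤ) R).ext fun α => ?_
    have h₂ := hS α α
    rw [sub_self, twistEquiv_apply, twistEquiv_apply, neg_zero, zmon_zero, one_mul] at h₂
    rw [basis_eq_zmon, LinearMap.mulLeft_apply, h₂, mul_comm, zmon_mul_cancel _ _ (by simp)]
  · rintro ⟨g, rfl⟩ j
    refine LinearMap.ext fun x => ?_
    rw [torusDiffLin_apply, LinearMap.mulLeft_apply, LinearMap.mulLeft_apply, mul_left_comm,
      zmon_mul_cancel _ _ (by simp), sub_self, LinearMap.zero_apply]

end TorusDifferential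

/-- The Koszul-type complex `C^k = Hom_R(Γₙ,Γₙ) ⊗ ⋀^k(Rⁿ)` with differential
`∂(φ ⊗ ω) = Σⱼ dⱼ(φ) ⊗ (eⱼ ∧ ω)` satisfies `∂ ∘ ∂ = 0`; its degree-0 kernel is exactly
`{M_g ⊗ 1 : g ∈ Γₙ} ≅ Γₙ`, and it is exact in every positive degree.  That is, its cohomology
is the group ring `Γₙ` concentrated in degree `0`, embedded as the multiplication operators. -/
theorem torus_koszul_complex_cohomology (R : Type*) [CommRing R] (n : ℕ) :
    (∀ (k : ℕ) (x : (AddMonoidAlgebra R (Fin n → ℤ) →ₗ[R] AddMonoidAlgebra R (Fin n → ℤ)) ⊗[R]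
        (⋀[R]^k (Fin n → R))), koszulD R n (k + 1) (koszulD R n k x) = 0) ∧
    (∀ x : (AddMonoidAlgebra R (Fin n → ℤ) →ₗ[R] AddMonoidAlgebra R (Fin n → ℤ)) ⊗[R]
        (⋀[R]^0 (Fin n → R)),
      koszulD R n 0 x = 0 ↔
        ∃ g : AddMonoidAlgebra R (Fin n → ℤ),
          x = (LinearMap.mulLeft R g) ⊗ₜ[R] extOne R (Fin n → R)) ∧
    Function.Injective (fun g : AddMonoidAlgebra R (Fin n → ℤ) =>
      (LinearMap.mulLeft R g) ⊗ₜ[R] extOne R (Fin n → R)) ∧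
    (∀ (k : ℕ) (x : (AddMonoidAlgebra R (Fin n → ℤ) →ₗ[R] AddMonoidAlgebra R (Fin n → ℤ)) ⊗[R]
        (⋀[R]^(k + 1) (Fin n → R))),
      koszulD R n (k + 1) x = 0 ↔ ∃ y, koszulD R n k y = x) := by
  have hK : ∀ k, koszulD R n k = koszulMap (torusDiffLin R n) k := fun _ => rfl
  have hd : ∀ i j φ, torusDiffLin R n i (torusDiffLin R n j φ) =
      torusDiffLin R n j (torusDiffLin R n i φ) := fun i j φ =>
    (twistEquiv R n).injective (by simp only [twistEquiv_torusDiffLin, partialDifference_comm i j])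
  simp only [hK]
  refine ⟨koszulMap_koszulMap _ hd, fun x => ?_, fun g g' h => ?_, ?_⟩
  · obtain ⟨φ, rfl⟩ := exists_eq_tmul_extOne x
    rw [koszulMap_zero_tmul_extOne_eq_zero_iff, forall_torusDiffLin_eq_zero_iff]
    exact exists_congr fun g => (tmul_extOne_injective.eq_iff).symm
  · simpa using LinearMap.congr_fun (tmul_extOne_injective h) 1
  · refine koszulMap_exact _ (fun i => (twistEquiv R n).symm.toLinearMap ∘ₗ
      partialIntegral R i ∘ₗ (twistEquiv R n).toLinearMap) hd (fun i φ => ?_)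
      (fun i j hij φ => ?_)
    · apply (twistEquiv R n).injective
      simp [twistEquiv_torusDiffLin, partialDifference_partialIntegral]
    · apply (twistEquiv R n).injective
      simp [twistEquiv_torusDiffLin, partialDifference_partialIntegral_of_ne hij]
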